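/- Let N₁, N₂ ∈ ℝ⁸ be orthonormal vectors, V = {x ∈ ℝ⁸ : ⟨x,N₁⟩ = ⟨x,N₂⟩ = 0}, and Jx = P(N₁,N₂,x) for x ∈ V. Then for all x, y, z ∈ V: Φ(N₁, Jx, y, z) = −σ Φ(N₂, x, y, z). (This says that the complex 3-form Ψ = f*(N₁⌟Φ) + iσ f*(N₂⌟Φ) on V is of type (3,0) with respect to J, i.e. J_(1)Ψ₊ = Ψ₋.) -/

import Mathlib

open scoped BigOperators RealInnerProductSpace

noncomputable section

abbrev Form (n p : ℕ) := (Fin p → EuclideanSpace ℝ (Fin n)) → ℝ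

namespace Form

/-- Wedge product of forms (shuffle convention; full antisymmetrization divided by p!q!). -/
def wedge {n p q : ℕ} (α : Form n p) (β : Form n q) : Form n (p + q) :=
  fun x =>
    (((p.factorial * q.factorial : ℕ) : ℝ))⁻¹ *
      ∑ σ : Equiv.Perm (Fin (p + q)),
        ((Equiv.Perm.sign σ : ℤ) : ℝ) *
          (α fun i => x (σ (Fin.castAdd q i))) * (β fun j => x (σ (Fin.natAdd p j)))

/-- Inner product of `p`-forms. -/
def inner' {n p : ℕ} (α β : Form n p) : ℝ :=
  ((p.factorial : ℕ) : ℝ)⁻¹ *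
    ∑ f : Fin p → Fin n,
      (α fun k => EuclideanSpace.single (f k) 1) * (β fun k => EuclideanSpace.single (f k) 1)

/-- Interior product of a vector and a form. -/
def iprod {n p : ℕ} (v : EuclideanSpace ℝ (Fin n)) (α : Form n (p + 1)) : Form n p :=
  fun x => α (Fin.cons v x)

end Form

infixl:72 " ⋏ " => Form.wedge

/-- The 1-form dual to a vector. -/
def dual {n : ℕ} (v : EuclideanSpace ℝ (Fin n)) : Form n 1 := fun x => ⟪v, x 0⟫

abbrev E8 := EuclideanSpace ℝ (Fin 8)

/-- The basis vector `e`. -/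
def e8 : E8 := EuclideanSpace.single 7 1

/-- The basis vectors `e₀,…,e₆` indexed mod 7. -/
def u7 (i : ZMod 7) : E8 := EuclideanSpace.single ⟨i.val, i.val_lt.trans (by norm_num)⟩ 1

/-- The basis indexed by ℤ₈, with `e₇ = e`. -/
def u8 (i : ZMod 8) : E8 := EuclideanSpace.single ⟨i.val, i.val_lt⟩ 1

/-- The Spin(7) fundamental 4-form. -/
def Phi (σ : ℝ) : Form 8 4 := fun x =>
  (∑ i : ZMod 7, (dual e8 ⋏ dual (u7 i) ⋏ dual (u7 (i + 1)) ⋏ dual (u7 (i + 3))) x)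
    - σ * ∑ i : ZMod 7,
        (dual (u7 (i + 2)) ⋏ dual (u7 (i + 4)) ⋏ dual (u7 (i + 5)) ⋏ dual (u7 (i + 6))) x

/-- The standard volume form of ℝ⁸. -/
def vol8 : Form 8 8 :=
  dual e8 ⋏ dual (u7 0) ⋏ dual (u7 1) ⋏ dual (u7 2) ⋏ dual (u7 3) ⋏ dual (u7 4) ⋏ dual (u7 5)
    ⋏ dual (u7 6)

/-- The 2-forms spanning spin(7)ᗮ. -/
def beta (σ : ℝ) (i : ZMod 7) : Form 8 2 := fun x =>
  σ * (dual (u7 i) ⋏ dual e8) x + (dual (u7 (i + 1)) ⋏ dual (u7 (i + 3))) x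
    + (dual (u7 (i + 4)) ⋏ dual (u7 (i + 5))) x + (dual (u7 (i + 2)) ⋏ dual (u7 (i + 6))) x

/-- The decomposable form `v 0 ∧ … ∧ v (k - 1)`. -/
def detForm {n k : ℕ} (v : Fin k → EuclideanSpace ℝ (Fin n)) : Form n k :=
  fun x => (Matrix.of fun i j => ⟪v i, x j⟫).det

theorem detForm_apply {n k : ℕ} (v x : Fin k → EuclideanSpace ℝ (Fin n)) :
    detForm v x = ∑ τ : Equiv.Perm (Fin k),
      ((Equiv.Perm.sign τ : ℤ) : ℝ) * ∏ i, ⟪v i, x (τ i)⟫ := by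
  rw [detForm, ← Matrix.det_transpose, Matrix.det_apply']
  rfl

theorem dual_eq_detForm {n : ℕ} (u : EuclideanSpace ℝ (Fin n)) : dual u = detForm ![u] := by
  funext x
  simp [dual, detForm]

theorem detForm_wedge_dual {n k : ℕ} (v : Fin k → EuclideanSpace ℝ (Fin n))
    (u : EuclideanSpace ℝ (Fin n)) :
    detForm v ⋏ dual u = detForm (n := n) (k := k + 1) (Fin.snoc v u) := by
  funext x
  have key (ρ : Equiv.Perm (Fin k)) :
      ∑ τ : Equiv.Perm (Fin (k + 1)), ((Equiv.Perm.sign τ : ℤ) : ℝ) *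
        (((Equiv.Perm.sign ρ : ℤ) : ℝ) * ∏ i, ⟪v i, x (τ (Fin.castAdd 1 (ρ i)))⟫) *
          ⟪u, x (τ (Fin.natAdd k 0))⟫ =
      detForm (n := n) (k := k + 1) (Fin.snoc v u) x := by
    rw [detForm_apply]
    refine Fintype.sum_equiv
      (Equiv.mulRight (finSumFinEquiv.permCongr (Equiv.Perm.sumCongr ρ (1 : Equiv.Perm (Fin 1)))))
      _ _ fun τ => ?_
    have hlast : (finSumFinEquiv (m := k) (n := 1)).symm (Fin.last k) = Sum.inr 0 :=
      finSumFinEquiv_symm_last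
    have hcast (i : Fin k) :
        (finSumFinEquiv (m := k) (n := 1)).symm i.castSucc = Sum.inl i :=
      finSumFinEquiv_symm_apply_castAdd i
    simp only [Equiv.coe_mulRight, Equiv.Perm.sign_mul, Equiv.Perm.sign_permCongr,
      Equiv.Perm.sign_sumCongr, Fin.prod_univ_castSucc, Fin.snoc_castSucc, Fin.snoc_last,
      Equiv.Perm.mul_apply, Equiv.permCongr_apply, hlast, hcast, Equiv.Perm.sumCongr_apply,
      Sum.map_inl, Sum.map_inr, finSumFinEquiv_apply_left, finSumFinEquiv_apply_right]
    simp
    ring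
  calc
    _ = ((k.factorial : ℕ) : ℝ)⁻¹ * ∑ ρ : Equiv.Perm (Fin k),
        detForm (n := n) (k := k + 1) (Fin.snoc v u) x := by
      simp only [Form.wedge, detForm_apply v, dual, Nat.factorial_one, mul_one, Finset.mul_sum,
        Finset.sum_mul]
      rw [Finset.sum_comm]
      exact Finset.sum_congr rfl fun ρ _ => by rw [← key ρ, Finset.mul_sum]
    _ = _ := by
      rw [Finset.sum_const, Finset.card_univ, Fintype.card_perm, Fintype.card_fin, nsmul_eq_mul,
        inv_mul_cancel_left₀ (Nat.cast_ne_zero.mpr k.factorial_ne_zero)]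

theorem dual_wedge_four {n : ℕ} (a b c d : EuclideanSpace ℝ (Fin n)) :
    dual a ⋏ dual b ⋏ dual c ⋏ dual d = detForm ![a, b, c, d] := by
  rw [dual_eq_detForm a, detForm_wedge_dual, detForm_wedge_dual, detForm_wedge_dual]
  congr 1
  funext i
  fin_cases i <;> rfl

/-- The coordinate expression of the wedge product of the basis 1-forms `i, j, k, l`. -/
def minorFour (i j k l : Fin 8) (x y z w : Fin 8 → ℝ) : ℝ :=
  (!![x i, y i, z i, w i; x j, y j, z j, w j; x k, y k, z k, w k; x l, y l, z l, w l]).det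

/-- The coordinate expression of `Phi`. -/
def phiCoord (σ : ℝ) (x y z w : Fin 8 → ℝ) : ℝ :=
  ∑ i : Fin 7, minorFour 7 i.castSucc (i + 1).castSucc (i + 3).castSucc x y z w -
    σ * ∑ i : Fin 7, minorFour (i + 2).castSucc (i + 4).castSucc (i + 5).castSucc
      (i + 6).castSucc x y z w

theorem Phi_eq_phiCoord (σ : ℝ) (x y z w : E8) :
    Phi σ ![x, y, z, w] = phiCoord σ x y z w := by
  have h (p q r s : Fin 8) :
      detForm ![EuclideanSpace.single p 1, EuclideanSpace.single q 1, EuclideanSpace.single r 1,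
        EuclideanSpace.single s 1] ![x, y, z, w] = minorFour p q r s x y z w := by
    unfold detForm minorFour
    congr 1
    ext i j
    fin_cases i <;> fin_cases j <;> simp [EuclideanSpace.inner_single_left]
  simp only [Phi, dual_wedge_four, e8, u7, h, phiCoord]
  rfl

theorem minorFour_eq (i j k l : Fin 8) (x y z w : Fin 8 → ℝ) :
    minorFour i j k l x y z w =
      (x i * y j - x j * y i) * (z k * w l - z l * w k)
      - (x i * y k - x k * y i) * (z j * w l - z l * w j)
      + (x i * y l - x l * y i) * (z j * w k - z k * w j)
      + (x j * y k - x k * y j) * (z i * w l - z l * w i)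
      - (x j * y l - x l * y j) * (z i * w k - z k * w i)
      + (x k * y l - x l * y k) * (z i * w j - z j * w i) := by
  simp [minorFour, Matrix.det_succ_row_zero, Fin.sum_univ_succ, Fin.succAbove]
  ring

theorem phiCoord_eq (σ : ℝ) (x y z w : Fin 8 → ℝ) :
    phiCoord σ x y z w =
      (minorFour 7 0 1 3 x y z w + minorFour 7 1 2 4 x y z w + minorFour 7 2 3 5 x y z w +
        minorFour 7 3 4 6 x y z w + minorFour 7 4 5 0 x y z w + minorFour 7 5 6 1 x y z w +
        minorFour 7 6 0 2 x y z w) -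
      σ * (minorFour 2 4 5 6 x y z w + minorFour 3 5 6 0 x y z w + minorFour 4 6 0 1 x y z w +
        minorFour 5 0 1 2 x y z w + minorFour 6 1 2 3 x y z w + minorFour 0 2 3 4 x y z w +
        minorFour 1 3 4 5 x y z w) := by
  simp only [phiCoord, Fin.sum_univ_seven]
  rfl

theorem phiCoord_eq_sum (σ : ℝ) (x y z w : Fin 8 → ℝ) :
    phiCoord σ x y z w = ∑ l, phiCoord σ x y z (Pi.single l 1) * w l := by
  simp only [Fin.sum_univ_eight, phiCoord_eq, minorFour_eq, Pi.single_apply]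
  simp
  ring

/-- The cyclic shift of the coordinates `0, …, 6`, which preserves `Phi`. -/
def coordShift : Equiv.Perm (Fin 8) where
  toFun := ![1, 2, 3, 4, 5, 6, 0, 7]
  invFun := ![6, 0, 1, 2, 3, 4, 5, 7]
  left_inv := by decide
  right_inv := by decide

theorem phiCoord_comp_coordShift (σ : ℝ) (x y z w : Fin 8 → ℝ) :
    phiCoord σ (x ∘ coordShift) (y ∘ coordShift) (z ∘ coordShift) (w ∘ coordShift) =
      phiCoord σ x y z w := by
  have h (i j k l : Fin 8) :
      minorFour i j k l (x ∘ coordShift) (y ∘ coordShift) (z ∘ coordShift) (w ∘ coordShift) =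
        minorFour (coordShift i) (coordShift j) (coordShift k) (coordShift l) x y z w := rfl
  simp only [phiCoord_eq, h]
  simp only [coordShift, Equiv.coe_fn_mk, Matrix.cons_val]
  ring

/-- The product identity for `⟪P a b x, P a y e_l⟫`, where `p` has the coordinates of `P a b x`. -/
def CrossIdentity (σ : ℝ) (l : Fin 8) : Prop :=
  ∀ a b x y p : Fin 8 → ℝ, (∀ m, p m = phiCoord σ a b x (Pi.single m 1)) →
    phiCoord σ a p y (Pi.single l 1) =
      -σ * (a ⬝ᵥ a * phiCoord σ b x y (Pi.single l 1) - a ⬝ᵥ b * phiCoord σ a x y (Pi.single l 1)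
        - a ⬝ᵥ x * phiCoord σ b a y (Pi.single l 1) - a ⬝ᵥ y * phiCoord σ b x a (Pi.single l 1)
        - a l * phiCoord σ b x y a)
      + !![a ⬝ᵥ a, a ⬝ᵥ y, a l; a ⬝ᵥ b, b ⬝ᵥ y, b l; a ⬝ᵥ x, x ⬝ᵥ y, x l].det

theorem CrossIdentity.shift {σ : ℝ} {l : Fin 8} (h : CrossIdentity σ l) :
    CrossIdentity σ (coordShift l) := by
  intro a b x y p hp
  have hsingle (m : Fin 8) :
      (Pi.single m 1 : Fin 8 → ℝ) = Pi.single (coordShift m) 1 ∘ coordShift := by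
    funext i
    simp [Pi.single_apply]
  have hl := h (a ∘ coordShift) (b ∘ coordShift) (x ∘ coordShift)
    (y ∘ coordShift) (p ∘ coordShift) fun m => by
      rw [hsingle, phiCoord_comp_coordShift, ← hp, Function.comp_apply]
  simpa only [hsingle l, phiCoord_comp_coordShift, comp_equiv_dotProduct_comp_equiv,
    Function.comp_apply] using hl

set_option maxHeartbeats 2000000 in
theorem crossIdentity_zero {σ : ℝ} (hσ : σ = 1 ∨ σ = -1) : CrossIdentity σ 0 := by
  intro a b x y p hp
  rcases hσ with rfl | rfl <;>
    simp [hp, phiCoord_eq, minorFour_eq, Matrix.det_fin_three, dotProduct, Fin.sum_univ_eight] <;>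
    ring

set_option maxHeartbeats 2000000 in
theorem crossIdentity_seven {σ : ℝ} (hσ : σ = 1 ∨ σ = -1) : CrossIdentity σ 7 := by
  intro a b x y p hp
  rcases hσ with rfl | rfl <;>
    simp [hp, phiCoord_eq, minorFour_eq, Matrix.det_fin_three, dotProduct, Fin.sum_univ_eight] <;>
    ring

theorem crossIdentity {σ : ℝ} (hσ : σ = 1 ∨ σ = -1) (l : Fin 8) : CrossIdentity σ l := by
  have h₀ := crossIdentity_zero hσ
  have h₁ : CrossIdentity σ 1 := h₀.shift
  have h₂ : CrossIdentity σ 2 := h₁.shift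
  have h₃ : CrossIdentity σ 3 := h₂.shift
  have h₄ : CrossIdentity σ 4 := h₃.shift
  have h₅ : CrossIdentity σ 5 := h₄.shift
  have h₆ : CrossIdentity σ 6 := h₅.shift
  have h₇ := crossIdentity_seven hσ
  exact match l with
    | 0 => h₀
    | 1 => h₁
    | 2 => h₂
    | 3 => h₃
    | 4 => h₄
    | 5 => h₅
    | 6 => h₆
    | 7 => h₇

/-- with `Jx = P(N₁,N₂,x)` on `V = {x : ⟨x,N₁⟩ = ⟨x,N₂⟩ = 0}`, for all
`x,y,z ∈ V`: `Φ(N₁,Jx,y,z) = −σΦ(N₂,x,y,z)`. -/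
theorem stmt18 (σ : ℝ) (hσ : σ = 1 ∨ σ = -1)
    (P : E8 → E8 → E8 → E8) (hP : ∀ x y z w : E8, ⟪P x y z, w⟫ = Phi σ ![x, y, z, w])
    (N₁ N₂ : E8) (hN₁ : ⟪N₁, N₁⟫ = 1) (hN₂ : ⟪N₂, N₂⟫ = 1) (hN₁₂ : ⟪N₁, N₂⟫ = 0)
    (x y z : E8) (hx : ⟪x, N₁⟫ = 0) (hx' : ⟪x, N₂⟫ = 0) (hy : ⟪y, N₁⟫ = 0) (hy' : ⟪y, N₂⟫ = 0)
    (hz : ⟪z, N₁⟫ = 0) (hz' : ⟪z, N₂⟫ = 0) :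
    Phi σ ![N₁, P N₁ N₂ x, y, z] = -σ * Phi σ ![N₂, x, y, z] := by
  have hdot (u v : E8) : ⟪u, v⟫ = (v : Fin 8 → ℝ) ⬝ᵥ u := by
    rw [EuclideanSpace.inner_eq_star_dotProduct]
    rfl
  have hp (m : Fin 8) : P N₁ N₂ x m = phiCoord σ N₁ N₂ x (Pi.single m 1) := by
    have h := hP N₁ N₂ x (EuclideanSpace.single m 1)
    rw [Phi_eq_phiCoord, EuclideanSpace.inner_single_right] at h
    simpa using h
  rw [hdot] at hN₁ hx hy hy' hz hz'
  rw [real_inner_comm, hdot] at hN₁₂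
  rw [Phi_eq_phiCoord, Phi_eq_phiCoord, phiCoord_eq_sum, phiCoord_eq_sum σ N₂]
  have key (l : Fin 8) :
      phiCoord σ N₁ (P N₁ N₂ x) y (Pi.single l 1) * z l =
        -σ * (phiCoord σ N₂ x y (Pi.single l 1) * z l)
          + σ * phiCoord σ N₂ x y N₁ * (N₁ l * z l) - (x : Fin 8 → ℝ) ⬝ᵥ y * (N₂ l * z l) := by
    rw [crossIdentity hσ l N₁ N₂ x y _ hp, Matrix.det_fin_three]
    simp [hN₁, hN₁₂, hx, hy, hy']
    ring
  simp only [key, Finset.sum_add_distrib, Finset.sum_sub_distrib, ← Finset.mul_sum]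
  simp only [dotProduct] at hz hz'
  rw [hz, hz']
  ring
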